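/- Theorem 1 (achievability). Let F be a finite field, let K ≥ 1, N ≥ 1 be integers, let t be an integer with 0 ≤ t ≤ K, and let B ≥ 1 be an integer with C(K,t) dividing B. Then there exist subsets 𝒞_k ⊆ (Fin N) × (Fin B) with |𝒞_k| = N·(B/C(K,t))·C(K−1,t−1) for each k ∈ Fin K (an uncoded cache placement storing N·t·B/K symbols per user, i.e. memory M = N·t/K), such that for every demand matrix D ∈ Matrix (Fin K) (Fin N) F there exist an encoding function ψ_D : ((Fin N) → (Fin B) → F) → ((Fin ℓ(D)) → F), where ℓ(D) = (C(K,t+1) − C(K − rank_F(D), t+1))·(B/C(K,t)), and for each user k ∈ Fin K a decoding function ξ_{k,D} taking as input the restriction of the library to 𝒞_k together with ψ_D(library), such that for every library (F_1,…,F_N) ∈ ((Fin N) → (Fin B) → F) and every k, ξ_{k,D} outputs exactly Σ_{i=1}^N D_{k,i}·F_i ∈ F^B. In particular the achieved load ℓ(D)/B = (C(K,t+1) − C(K − rank_F(D), t+1))/C(K,t) depends on D only through rank_F(D). -/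

import Mathlib

open Module in
/-- The kernel of the map induced on exterior powers by passing to the quotient by `V`. -/
theorem exteriorPower.finrank_ker_map_mkQ {F E : Type*} [Field F] [AddCommGroup E] [Module F E]
    [FiniteDimensional F E] (V : Submodule F E) (n : ℕ) :
    finrank F (LinearMap.ker (exteriorPower.map n V.mkQ)) =
      (finrank F E).choose n - (finrank F E - finrank F V).choose n := by
  have hrn := LinearMap.finrank_range_add_finrank_ker (exteriorPower.map n V.mkQ)
  rw [LinearMap.range_eq_top.2 (exteriorPower.map_surjective V.mkQ_surjective), finrank_top,
    exteriorPower.finrank_eq, exteriorPower.finrank_eq] at hrn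
  have hV := V.finrank_quotient_add_finrank
  rw [show finrank F E - finrank F V = finrank F (E ⧸ V) by omega]
  omega

/-- Contraction by a functional vanishing on all the factors kills an exterior product. -/
theorem ExteriorAlgebra.contractLeft_ιMulti_eq_zero {R M : Type*} [CommRing R] [AddCommGroup M]
    [Module R M] (d : Module.Dual R M) {n : ℕ} (v : Fin n → M) (hv : ∀ i, d (v i) = 0) :
    CliffordAlgebra.contractLeft (Q := (0 : QuadraticForm R M)) d
      (ExteriorAlgebra.ιMulti R n v) = 0 := by
  induction n with
  | zero =>
    rw [ExteriorAlgebra.ιMulti_zero_apply]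
    exact CliffordAlgebra.contractLeft_one (Q := (0 : QuadraticForm R M)) d
  | succ n ih =>
    rw [ExteriorAlgebra.ιMulti_succ_apply]
    refine (CliffordAlgebra.contractLeft_ι_mul _ _ _).trans ?_
    rw [hv, ih (Matrix.vecTail v) fun i => hv i.succ, zero_smul, mul_zero, sub_zero]

section Delivery

variable {F : Type*} [Field F] {K N : ℕ}

/-- The multicast message of a block of the library, an element of the exterior power of `F ^ K`
whose coordinates are the signed combinations of the demanded subfiles. -/
noncomputable def multicast (D : Matrix (Fin K) (Fin N) F) (t : ℕ) :
    (Fin N → Set.powersetCard (Fin K) t → F) →ₗ[F] ⋀[F]^(t + 1) (Fin K → F) where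
  toFun x := ∑ T : Set.powersetCard (Fin K) t,
    exteriorPower.ιMulti F (t + 1) (Matrix.vecCons (D.mulVec fun i => x i T)
      (Pi.basisFun F (Fin K) ∘ Set.powersetCard.ofFinEmbEquiv.symm T))
  map_add' x y := by
    rw [← Finset.sum_add_distrib]
    refine Finset.sum_congr rfl fun T _ => ?_
    rw [← AlternatingMap.map_vecCons_add, ← Matrix.mulVec_add]
    rfl
  map_smul' c x := by
    rw [RingHom.id_apply, Finset.smul_sum]
    refine Finset.sum_congr rfl fun T _ => ?_
    rw [← AlternatingMap.map_vecCons_smul, ← Matrix.mulVec_smul]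
    rfl

theorem multicast_apply (D : Matrix (Fin K) (Fin N) F) (t : ℕ)
    (x : Fin N → Set.powersetCard (Fin K) t → F) :
    multicast D t x = ∑ T : Set.powersetCard (Fin K) t,
      exteriorPower.ιMulti F (t + 1) (Matrix.vecCons (D.mulVec fun i => x i T)
        (Pi.basisFun F (Fin K) ∘ Set.powersetCard.ofFinEmbEquiv.symm T)) := rfl

theorem multicast_mem_ker (D : Matrix (Fin K) (Fin N) F) (t : ℕ)
    (x : Fin N → Set.powersetCard (Fin K) t → F) :
    multicast D t x ∈
      LinearMap.ker (exteriorPower.map (t + 1) (LinearMap.range D.mulVecLin).mkQ) := by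
  rw [LinearMap.mem_ker, multicast_apply, map_sum]
  refine Finset.sum_eq_zero fun T _ => ?_
  rw [exteriorPower.map_apply_ιMulti]
  refine AlternatingMap.map_coord_zero _ 0 ?_
  simp only [Function.comp_apply, Matrix.cons_val_zero, Submodule.mkQ_apply]
  exact (Submodule.Quotient.mk_eq_zero _).2 ⟨_, rfl⟩

/-- User `k` can compute its demand from the multicast message and the subfiles indexed by the
subsets containing `k`. -/
theorem mulVec_eq_zero_of_multicast_eq_zero (D : Matrix (Fin K) (Fin N) F) (t : ℕ)
    (x : Fin N → Set.powersetCard (Fin K) t → F) (k : Fin K)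
    (hx : ∀ i T, k ∈ T → x i T = 0) (h : multicast D t x = 0) (T : Set.powersetCard (Fin K) t) :
    D.mulVec (fun i => x i T) k = 0 := by
  set b := Pi.basisFun F (Fin K)
  have hcached : ∀ T, k ∈ T → D.mulVec (fun i => x i T) = 0 := fun T hT => by
    rw [show (fun i => x i T) = 0 from funext fun i => hx i T hT, Matrix.mulVec_zero]
  have hcontract : ∑ T : Set.powersetCard (Fin K) t,
      D.mulVec (fun i => x i T) k • exteriorPower.ιMulti_family F t b T = 0 := by
    apply Subtype.ext
    have h' := congrArg (fun w : ⋀[F]^(t + 1) (Fin K → F) => CliffordAlgebra.contractLeft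
      (LinearMap.proj k : (Fin K → F) →ₗ[F] F) (w : ExteriorAlgebra F (Fin K → F))) h
    simp only [multicast_apply, AddSubmonoidClass.coe_finsetSum, map_sum, ZeroMemClass.coe_zero,
      map_zero] at h'
    simp only [AddSubmonoidClass.coe_finsetSum, ZeroMemClass.coe_zero]
    rw [← h']
    refine Finset.sum_congr rfl fun T _ => ?_
    rw [exteriorPower.ιMulti_apply_coe, ExteriorAlgebra.ιMulti_succ_apply]
    refine Eq.symm ((CliffordAlgebra.contractLeft_ι_mul _ _ _).trans ?_)
    by_cases hT : k ∈ T
    · simp [hcached T hT]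
    · have hzero := ExteriorAlgebra.contractLeft_ιMulti_eq_zero
        (LinearMap.proj k : (Fin K → F) →ₗ[F] F)
        (b ∘ Set.powersetCard.ofFinEmbEquiv.symm T) (fun i => by
          have hne : Set.powersetCard.ofFinEmbEquiv.symm T i ≠ k := by
            rintro rfl
            exact hT ((Set.powersetCard.mem_range_ofFinEmbEquiv_symm_iff_mem T _).1 ⟨i, rfl⟩)
          simp [b, hne.symm])
      simp only [Matrix.cons_val_zero, Matrix.tail_cons] at hzero ⊢
      erw [hzero]
      simp
      rfl
  have hli := exteriorPower.ιMulti_family_linearIndependent_ofBasis F t b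
  exact Fintype.linearIndependent_iff.1 hli _ hcontract T

/-- For any splitting of the files in subfiles and any placement in which user `k` caches at least
the subfiles indexed by the subsets containing `k`, every demand can be delivered. -/
theorem exists_delivery {B t m : ℕ} (e : Fin B ≃ Set.powersetCard (Fin K) t × Fin m)
    (C : Fin K → Finset (Fin N × Fin B)) (hC : ∀ k p, k ∈ (e p.2).1 → p ∈ C k)
    (D : Matrix (Fin K) (Fin N) F) {d : ℕ}
    (hd : d = K.choose (t + 1) - (K - D.rank).choose (t + 1)) :
    ∃ ψ : (Fin N → Fin B → F) → (Fin (d * m) → F),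
    ∃ ξ : ∀ k : Fin K, ({p : Fin N × Fin B // p ∈ C k} → F) → (Fin (d * m) → F) → (Fin B → F),
      ∀ (lib : Fin N → Fin B → F) (k : Fin K) (b : Fin B),
        ξ k (fun p => lib p.1.1 p.1.2) (ψ lib) b = ∑ i, D k i * lib i b := by
  set V := LinearMap.range D.mulVecLin
  have hfin : Module.finrank F (LinearMap.ker (exteriorPower.map (t + 1) V.mkQ)) = d := by
    rw [exteriorPower.finrank_ker_map_mkQ, Module.finrank_fin_fun, hd]
    rfl
  have : Module.Free F (LinearMap.ker (exteriorPower.map (t + 1) V.mkQ)) :=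
    @Module.Free.of_divisionRing F (LinearMap.ker (exteriorPower.map (t + 1) V.mkQ)) _
      (Submodule.addCommGroup _) _
  let c := (Module.finBasisOfFinrankEq F _ hfin).equivFun
  let block (lib : Fin N → Fin B → F) (s : Fin m) : Fin N → Set.powersetCard (Fin K) t → F :=
    fun i T => lib i (e.symm (T, s))
  let ψ (lib : Fin N → Fin B → F) : Fin (d * m) → F := fun q =>
    c ⟨multicast D t (block lib (finProdFinEquiv.symm q).2), multicast_mem_ker D t _⟩
      (finProdFinEquiv.symm q).1
  let view (k : Fin K) (lib : Fin N → Fin B → F) :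
      ({p : Fin N × Fin B // p ∈ C k} → F) × (Fin (d * m) → F) :=
    (fun p => lib p.1.1 p.1.2, ψ lib)
  have key (k : Fin K) : Function.FactorsThrough
      (fun (lib : Fin N → Fin B → F) (b : Fin B) => ∑ i, D k i * lib i b) (view k) := by
    intro lib lib' h
    obtain ⟨hcache, hψ⟩ := Prod.mk.inj h
    funext b
    obtain ⟨⟨T, s⟩, rfl⟩ := e.symm.surjective b
    have hW : multicast D t (block lib s) = multicast D t (block lib' s) := by
      refine congrArg Subtype.val (c.injective (a₁ := ⟨_, multicast_mem_ker D t _⟩)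
        (a₂ := ⟨_, multicast_mem_ker D t _⟩) (funext fun j => ?_))
      have hj := congrFun hψ (finProdFinEquiv (j, s))
      simp only [ψ, Equiv.symm_apply_apply] at hj
      exact hj
    have hzero := mulVec_eq_zero_of_multicast_eq_zero D t (block lib s - block lib' s) k
      (fun i T hT => sub_eq_zero.2
        (congrFun hcache ⟨(i, e.symm (T, s)), hC k _ (by simpa using hT)⟩))
      (by rw [map_sub, hW, sub_self]) T
    simpa [Matrix.mulVec, dotProduct, block, mul_sub, sub_eq_zero] using hzero
  refine ⟨ψ, fun k y z => Function.extend (view k) (fun lib b => ∑ i, D k i * lib i b) 0 (y, z),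
    fun lib k b => ?_⟩
  exact congrFun ((key k).extend_apply 0 lib) b

end Delivery

/-- The number of subsets of size `n + 1` containing a given element. -/
theorem Set.powersetCard.card_filter_mem {α : Type*} [Fintype α] [DecidableEq α] (a : α) (n : ℕ) :
    Fintype.card {T : Set.powersetCard α (n + 1) // a ∈ T.1} = (Fintype.card α - 1).choose n := by
  have hcard : (Finset.univ.erase a).card = Fintype.card α - 1 := by
    rw [Finset.card_erase_of_mem (Finset.mem_univ a), Finset.card_univ]
  rw [← hcard, ← Finset.card_powersetCard, ← Fintype.card_coe]
  refine Fintype.card_congr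
    { toFun := fun T => ⟨T.1.1.erase a, ?_⟩
      invFun := fun S => ⟨⟨insert a S.1, ?_⟩, ?_⟩
      left_inv := ?_
      right_inv := ?_ }
  · rw [Finset.mem_powersetCard]
    refine ⟨Finset.erase_subset_erase _ (Finset.subset_univ _), ?_⟩
    rw [Finset.card_erase_of_mem T.2, show T.1.1.card = n + 1 from T.1.2, Nat.add_sub_cancel]
  · have hS := Finset.mem_powersetCard.1 S.2
    rw [Set.powersetCard.mem_iff, Finset.card_insert_of_notMem, hS.2]
    exact fun h => Finset.notMem_erase a _ (hS.1 h)
  · exact Finset.mem_insert_self a _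
  · rintro ⟨T, hT⟩
    exact Subtype.ext (Subtype.ext (Finset.insert_erase hT))
  · intro S
    have hS := Finset.mem_powersetCard.1 S.2
    exact Subtype.ext (Finset.erase_insert fun h => Finset.notMem_erase a _ (hS.1 h))


/-- Theorem 1 (achievability) for the shared-link cache-aided scalar linear function
retrieval problem: with MAN-type uncoded cache placement of memory `M = N*t/K`, for every
demand matrix `D` the load `(C(K,t+1) - C(K - rank D, t+1)) / C(K,t)` is achievable. -/
theorem thm1_achievability (F : Type) [Field F] [Fintype F]
    (K N t B : ℕ) (hK : 1 ≤ K) (hN : 1 ≤ N) (hB : 1 ≤ B) (ht : t ≤ K)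
    (hdvd : K.choose t ∣ B) :
    ∃ C : Fin K → Finset (Fin N × Fin B),
      (∀ k, (C k).card = N * (B / K.choose t) * ((K - 1).choose (t - 1))) ∧
      ∀ D : Matrix (Fin K) (Fin N) F,
        ∃ ψ : (Fin N → Fin B → F) →
            (Fin ((K.choose (t + 1) - (K - D.rank).choose (t + 1)) * (B / K.choose t)) → F),
        ∃ ξ : ∀ k : Fin K, ({p : Fin N × Fin B // p ∈ C k} → F) →
            (Fin ((K.choose (t + 1) - (K - D.rank).choose (t + 1)) * (B / K.choose t)) → F) →
            (Fin B → F),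
          ∀ (lib : Fin N → Fin B → F) (k : Fin K) (b : Fin B),
            ξ k (fun p => lib p.1.1 p.1.2) (ψ lib) b = ∑ i, D k i * lib i b := by
  classical
  have hcard : Fintype.card (Set.powersetCard (Fin K) t) = K.choose t := by
    rw [Fintype.card_eq_nat_card, Set.powersetCard.card, Nat.card_fin]
  let e : Fin B ≃ Set.powersetCard (Fin K) t × Fin (B / K.choose t) := Fintype.equivOfCardEq (by
    rw [Fintype.card_prod, hcard, Fintype.card_fin, Fintype.card_fin, Nat.mul_div_cancel' hdvd])
  cases t with
  | zero =>
    refine ⟨fun _ => Finset.univ, fun k => by simp, fun D => ?_⟩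
    exact exists_delivery e _ (fun _ _ _ => Finset.mem_univ _) D rfl
  | succ n =>
    refine ⟨fun k => Finset.univ.filter fun p => k ∈ (e p.2).1, fun k => ?_, fun D => ?_⟩
    · rw [← Fintype.card_subtype]
      let g : {p : Fin N × Fin B // k ∈ (e p.2).1} ≃
          Fin N × {T : Set.powersetCard (Fin K) (n + 1) // k ∈ T.1} × Fin (B / K.choose (n + 1)) :=
        { toFun := fun p => (p.1.1, ⟨(e p.1.2).1, p.2⟩, (e p.1.2).2)
          invFun := fun q => ⟨(q.1, e.symm (q.2.1.1, q.2.2)), by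
            rw [Equiv.apply_symm_apply]; exact q.2.1.2⟩
          left_inv := fun p => by simp
          right_inv := fun q => by simp }
      rw [Fintype.card_congr g, Fintype.card_prod, Fintype.card_prod,
        Set.powersetCard.card_filter_mem, Fintype.card_fin, Fintype.card_fin, Fintype.card_fin,
        Nat.add_sub_cancel]
      ring
    · exact exists_delivery e _ (fun k p h => by simpa using h) D rfl
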